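/- Fix ξ ∈ (0,1), η ∈ (0, ξ), integers d_v, d_c ≥ 2, and ΔR ∈ (0, 1−ξ). Consider the optimization problem: minimize F(λ, ρ, η) = ∫_η^ξ dx/( x − ξ·λ(1−ρ(1−x)) ) over all pairs (λ, ρ) of degree distributions with maximal degrees at most d_v and d_c respectively, subject to ξ·λ(1−ρ(1−x)) < x for all x ∈ (0, ξ] and (∫₀¹ρ)/(∫₀¹λ) = 1 − (1−ξ) + ΔR. Suppose ξ ≤ 1 − e^{−2/d_c}, and let (λ*, ρ*) be a solution of this problem. Then the coefficients ρ*_j of ρ* are nonzero for at most two indices j. -/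

import Mathlib

open scoped BigOperators

/-- A degree distribution: a real polynomial `γ(x) = ∑_{i=2}^{D} γ_i x^(i-1)` whose
coefficients are nonnegative and sum to `1`; `D` (the largest index with `γ_D ≠ 0`)
is called the maximal degree. -/
structure DegreeDist where
  c : ℕ → ℝ
  D : ℕ
  two_le_D : 2 ≤ D
  nonneg : ∀ i, 0 ≤ c i
  supp : ∀ i, c i ≠ 0 → 2 ≤ i ∧ i ≤ D
  cD_ne : c D ≠ 0
  sum_eq_one : ∑ i ∈ Finset.Icc 2 D, c i = 1

/-- Evaluation of a degree distribution at a real `x`. -/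
noncomputable def DegreeDist.eval (γ : DegreeDist) (x : ℝ) : ℝ :=
  ∑ i ∈ Finset.Icc 2 γ.D, γ.c i * x ^ (i - 1)

/-- For `a > 0` the function `u ↦ exp (-a / u)` is strictly concave on `[b, ∞)` when `a ≤ 2 b`. -/
theorem strictConcaveOn_exp_neg_div {a b : ℝ} (ha : 0 < a) (hab : a ≤ 2 * b) :
    StrictConcaveOn ℝ (Set.Ici b) fun u : ℝ => Real.exp (-a / u) := by
  have hb : 0 < b := by linarith
  have hderiv : ∀ u : ℝ, 0 < u →
      HasDerivAt (fun u : ℝ => Real.exp (-a / u)) (Real.exp (-a / u) * (a / u ^ 2)) u := by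
    intro u hu
    have h : HasDerivAt (fun u : ℝ => -a / u) (a / u ^ 2) u := by
      refine ((hasDerivAt_const u (-a)).fun_div (hasDerivAt_id' u) hu.ne').congr_deriv ?_
      ring
    exact h.exp
  refine strictConcaveOn_of_deriv2_neg (convex_Ici b) ?_ ?_
  · intro u hu
    exact (hderiv u (hb.trans_le hu)).continuousAt.continuousWithinAt
  · intro u hu
    rw [interior_Ici] at hu
    have hbu : b < u := hu
    have hu0 : 0 < u := hb.trans hbu
    have heq : deriv (fun u : ℝ => Real.exp (-a / u)) =ᶠ[nhds u]
        fun u => Real.exp (-a / u) * (a / u ^ 2) := by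
      filter_upwards [lt_mem_nhds hu0] with v hv
      exact (hderiv v hv).deriv
    have h2 : HasDerivAt (fun u : ℝ => a / u ^ 2) (-(2 * a) / u ^ 3) u := by
      refine ((hasDerivAt_const u a).fun_div (hasDerivAt_pow 2 u)
        (pow_ne_zero 2 hu0.ne')).congr_deriv ?_
      field_simp
      norm_num
      ring
    have h3 := (hderiv u hu0).mul h2
    rw [Function.iterate_succ, Function.iterate_one, Function.comp_apply, heq.deriv_eq]
    refine h3.deriv.trans_lt ?_
    have : Real.exp (-a / u) * (a / u ^ 2) * (a / u ^ 2) + Real.exp (-a / u) * (-(2 * a) / u ^ 3)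
        = Real.exp (-a / u) * (a / u ^ 4) * (a - 2 * u) := by
      field_simp
      ring
    rw [this]
    exact mul_neg_of_pos_of_neg (by positivity) (by linarith)

/-- If `1 / j` is a proper convex combination of `1 / i` and `1 / k`, then `y ^ (j - 1)` exceeds the
same combination of `y ^ (i - 1)` and `y ^ (k - 1)` for `y` close to `1`. -/
theorem convexCombo_pow_pred_lt {d i j k : ℕ} (hi : 0 < i) (hij : i < j) (hjk : j < k) (hkd : k ≤ d)
    {t y : ℝ} (ht0 : 0 < t) (ht1 : t < 1)
    (ht : t * (1 / (i : ℝ)) + (1 - t) * (1 / (k : ℝ)) = 1 / (j : ℝ))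
    (hy : Real.exp (-2 / (d : ℝ)) ≤ y) (hy1 : y < 1) :
    t * y ^ (i - 1) + (1 - t) * y ^ (k - 1) < y ^ (j - 1) := by
  have hy0 : 0 < y := (Real.exp_pos _).trans_le hy
  have hlog : -2 / (d : ℝ) ≤ Real.log y := (Real.le_log_iff_exp_le hy0).2 hy
  have hpow : ∀ n : ℕ, Real.exp (-(-Real.log y) / (1 / (n : ℝ))) = y ^ n := by
    intro n
    rw [neg_neg, div_div_eq_mul_div, div_one, mul_comm, Real.exp_nat_mul, Real.exp_log hy0]
  have hmem : ∀ n : ℕ, 0 < n → n ≤ d → 1 / (n : ℝ) ∈ Set.Ici (1 / (d : ℝ)) := fun n hn hnd =>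
    Set.mem_Ici.2 (one_div_le_one_div_of_le (Nat.cast_pos.2 hn) (Nat.cast_le.2 hnd))
  have hne : 1 / (i : ℝ) ≠ 1 / (k : ℝ) := by
    have : (i : ℝ) ≠ k := by exact_mod_cast (hij.trans hjk).ne
    simpa using this
  have h := (strictConcaveOn_exp_neg_div (a := -Real.log y) (b := 1 / (d : ℝ))
    (neg_pos.2 (Real.log_neg hy0 hy1)) (by
      have : -2 / (d : ℝ) = -(2 * (1 / (d : ℝ))) := by ring
      linarith)).2 (hmem i hi (by omega)) (hmem k (by omega) hkd) hne ht0 (sub_pos.2 ht1)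
      (by ring)
  simp only [smul_eq_mul, ht, hpow] at h
  have hsucc : ∀ n : ℕ, 0 < n → y ^ n = y ^ (n - 1) * y := fun n hn => by
    rw [← pow_succ, Nat.sub_add_cancel hn]
  rw [hsucc i hi, hsucc j (by omega), hsucc k (by omega)] at h
  exact lt_of_mul_lt_mul_right (by linarith) hy0.le

namespace DegreeDist

theorem integral_eval (γ : DegreeDist) :
    ∫ t in (0 : ℝ)..1, γ.eval t = ∑ i ∈ Finset.Icc 2 γ.D, γ.c i * (1 / (i : ℝ)) := by
  unfold eval
  rw [intervalIntegral.integral_finsetSum fun i _ =>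
    (Continuous.intervalIntegrable (by fun_prop) _ _)]
  refine Finset.sum_congr rfl fun i hi => ?_
  have hi1 : 1 ≤ i := by
    have := (Finset.mem_Icc.1 hi).1
    omega
  rw [intervalIntegral.integral_const_mul, integral_pow, Nat.cast_sub hi1, Nat.sub_add_cancel hi1]
  simp [show i ≠ 0 by omega]

theorem continuous_eval (γ : DegreeDist) : Continuous γ.eval := by
  unfold eval
  fun_prop

theorem eval_lt_eval (γ : DegreeDist) {x y : ℝ} (hx : 0 ≤ x) (hxy : x < y) :
    γ.eval x < γ.eval y := by
  refine Finset.sum_lt_sum (fun i _ => ?_) ⟨γ.D, Finset.mem_Icc.2 ⟨γ.two_le_D, le_rfl⟩, ?_⟩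
  · exact mul_le_mul_of_nonneg_left (pow_le_pow_left₀ hx hxy.le _) (γ.nonneg i)
  · have := γ.two_le_D
    exact mul_lt_mul_of_pos_left (pow_lt_pow_left₀ hxy hx (by omega))
      ((γ.nonneg _).lt_of_ne' γ.cD_ne)

theorem eval_le_one (γ : DegreeDist) {x : ℝ} (hx : 0 ≤ x) (hx1 : x ≤ 1) : γ.eval x ≤ 1 := by
  rw [← γ.sum_eq_one]
  exact Finset.sum_le_sum fun i _ => mul_le_of_le_one_right (γ.nonneg i) (pow_le_one₀ hx hx1)

/-- Mass can be moved from two outer degrees `i` and `k` in the support to a degree `j` between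
them. -/
theorem exists_transfer (γ : DegreeDist) {i j k : ℕ} (hij : i < j) (hjk : j < k)
    (hi : γ.c i ≠ 0) (hk : γ.c k ≠ 0) {t : ℝ} (ht0 : 0 < t) (ht1 : t < 1) :
    ∃ (γ' : DegreeDist) (ε : ℝ), 0 < ε ∧ γ'.D = γ.D ∧ ∀ g : ℕ → ℝ,
      ∑ n ∈ Finset.Icc 2 γ'.D, γ'.c n * g n =
        ∑ n ∈ Finset.Icc 2 γ.D, γ.c n * g n + ε * (g j - (t * g i + (1 - t) * g k)) := by
  have hi2 := γ.supp i hi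
  have hk2 := γ.supp k hk
  have hi0 : 0 < γ.c i := (γ.nonneg i).lt_of_ne' hi
  have hk0 : 0 < γ.c k := (γ.nonneg k).lt_of_ne' hk
  obtain ⟨ε, hε0, hε⟩ := exists_between (lt_min hi0 hk0)
  have hεi : ε * t < γ.c i := by
    nlinarith [hε.trans_le (min_le_left _ _)]
  have hεk : ε * (1 - t) < γ.c k := by
    nlinarith [hε.trans_le (min_le_right _ _)]
  set c' : ℕ → ℝ := fun n => γ.c n + ε * ((if n = j then 1 else 0) -
    (t * (if n = i then 1 else 0) + (1 - t) * (if n = k then 1 else 0))) with hc'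
  have hsum : ∀ g : ℕ → ℝ, ∑ n ∈ Finset.Icc 2 γ.D, c' n * g n =
      ∑ n ∈ Finset.Icc 2 γ.D, γ.c n * g n + ε * (g j - (t * g i + (1 - t) * g k)) := by
    intro g
    have hone : ∀ m ∈ Finset.Icc 2 γ.D,
        ∑ n ∈ Finset.Icc 2 γ.D, (if n = m then 1 else 0) * g n = g m := by
      intro m hm
      simp only [ite_mul, one_mul, zero_mul]
      rw [Finset.sum_ite_eq' _ m, if_pos hm]
    rw [← hone i (Finset.mem_Icc.2 hi2), ← hone k (Finset.mem_Icc.2 hk2),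
      ← hone j (Finset.mem_Icc.2 (by omega))]
    simp only [Finset.mul_sum, ← Finset.sum_add_distrib, ← Finset.sum_sub_distrib]
    exact Finset.sum_congr rfl fun n _ => by simp only [hc']; ring
  have hci : c' i = γ.c i - ε * t := by
    simp [hc', hij.ne, (hij.trans hjk).ne]
    ring
  have hck : c' k = γ.c k - ε * (1 - t) := by
    simp [hc', hjk.ne', (hij.trans hjk).ne']
    ring
  have hcj : c' j = γ.c j + ε := by
    simp [hc', hij.ne', hjk.ne]
  have hcn : ∀ n, n ≠ i → n ≠ j → n ≠ k → c' n = γ.c n := by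
    intro n h1 h2 h3
    simp [hc', h1, h2, h3]
  have hjnn := γ.nonneg j
  refine ⟨⟨c', γ.D, γ.two_le_D, fun n => ?_, fun n hn => ?_, ?_, ?_⟩, ε, hε0, rfl, hsum⟩
  · by_cases h1 : n = i
    · subst h1; linarith
    by_cases h2 : n = j
    · subst h2; linarith
    by_cases h3 : n = k
    · subst h3; linarith
    rw [hcn n h1 h2 h3]
    exact γ.nonneg n
  · by_cases h1 : n = i
    · omega
    by_cases h2 : n = j
    · omega
    by_cases h3 : n = k
    · omega
    exact γ.supp n (hcn n h1 h2 h3 ▸ hn)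
  · by_cases h3 : γ.D = k
    · rw [h3]; linarith
    · rw [hcn _ (by omega) (by omega) h3]
      exact γ.cD_ne
  · have h := hsum fun _ => 1
    simp only [mul_one] at h
    rw [h, γ.sum_eq_one]
    ring

end DegreeDist

/-- if `ξ ≤ 1 − e^{−2/d_c}`, then any solution `(λ*, ρ*)` of the
convergence-time minimization problem has `ρ*` with at most two nonzero
coefficients. -/
theorem stmt17 (ξ η dR : ℝ) (dv dc : ℕ) (hξ : ξ ∈ Set.Ioo (0:ℝ) 1)
    (hη : η ∈ Set.Ioo (0:ℝ) ξ) (hdv : 2 ≤ dv) (hdc : 2 ≤ dc)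
    (hdR : dR ∈ Set.Ioo (0:ℝ) (1 - ξ))
    (hξdc : ξ ≤ 1 - Real.exp (-2 / (dc : ℝ)))
    (lams rhos : DegreeDist)
    (hfeas : lams.D ≤ dv ∧ rhos.D ≤ dc ∧
      (∀ x ∈ Set.Ioc (0:ℝ) ξ, ξ * lams.eval (1 - rhos.eval (1 - x)) < x) ∧
      (∫ t in (0:ℝ)..1, rhos.eval t) / (∫ t in (0:ℝ)..1, lams.eval t) =
        1 - (1 - ξ) + dR)
    (hmin : ∀ l r : DegreeDist,
      (l.D ≤ dv ∧ r.D ≤ dc ∧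
        (∀ x ∈ Set.Ioc (0:ℝ) ξ, ξ * l.eval (1 - r.eval (1 - x)) < x) ∧
        (∫ t in (0:ℝ)..1, r.eval t) / (∫ t in (0:ℝ)..1, l.eval t) =
          1 - (1 - ξ) + dR) →
      (∫ x in η..ξ, 1 / (x - ξ * lams.eval (1 - rhos.eval (1 - x)))) ≤
        (∫ x in η..ξ, 1 / (x - ξ * l.eval (1 - r.eval (1 - x))))) :
    ∃ j₁ j₂ : ℕ, ∀ j : ℕ, rhos.c j ≠ 0 → j = j₁ ∨ j = j₂ := by
  by_contra! hcon
  obtain ⟨hlD, hrD, hdec, hrate⟩ := hfeas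
  have hex : ∃ n, rhos.c n ≠ 0 := ⟨_, rhos.cD_ne⟩
  classical
  obtain ⟨j, hj, hji, hjD⟩ := hcon (Nat.find hex) rhos.D
  have hi : rhos.c (Nat.find hex) ≠ 0 := Nat.find_spec hex
  have hij : Nat.find hex < j := (Nat.find_min' hex hj).lt_of_ne' hji
  generalize Nat.find hex = i at hi hij
  have hjk : j < rhos.D := (rhos.supp j hj).2.lt_of_ne hjD
  have hi2 := (rhos.supp i hi).1
  obtain ⟨t, ht0, ht1, ht⟩ : ∃ t : ℝ, 0 < t ∧ t < 1 ∧
      t * (1 / (i : ℝ)) + (1 - t) * (1 / (rhos.D : ℝ)) = 1 / (j : ℝ) := by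
    have h1 : 1 / (rhos.D : ℝ) < 1 / (j : ℝ) :=
      one_div_lt_one_div_of_lt (by exact_mod_cast (by omega : 0 < j)) (by exact_mod_cast hjk)
    have h2 : 1 / (j : ℝ) < 1 / (i : ℝ) :=
      one_div_lt_one_div_of_lt (by exact_mod_cast (by omega : 0 < i)) (by exact_mod_cast hij)
    have h3 : 0 < 1 / (i : ℝ) - 1 / (rhos.D : ℝ) := by linarith
    refine ⟨(1 / (j : ℝ) - 1 / (rhos.D : ℝ)) / (1 / (i : ℝ) - 1 / (rhos.D : ℝ)),
      div_pos (by linarith) h3, (div_lt_one h3).2 (by linarith), ?_⟩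
    linear_combination div_mul_cancel₀ (1 / (j : ℝ) - 1 / (rhos.D : ℝ)) h3.ne'
  obtain ⟨r, ε, hε, hrD', hr⟩ := rhos.exists_transfer hij hjk hi rhos.cD_ne ht0 ht1
  have hlt : ∀ x ∈ Set.Ioc (0 : ℝ) ξ,
      lams.eval (1 - r.eval (1 - x)) < lams.eval (1 - rhos.eval (1 - x)) := by
    intro x hx
    have hpow := convexCombo_pow_pred_lt (by omega) hij hjk hrD ht0 ht1 ht
      (y := 1 - x) (by linarith [hx.2]) (by linarith [hx.1])
    have heval : rhos.eval (1 - x) < r.eval (1 - x) := by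
      have h := hr fun n => (1 - x) ^ (n - 1)
      have hpos := mul_pos hε (sub_pos.2 hpow)
      unfold DegreeDist.eval
      linarith
    refine lams.eval_lt_eval ?_ (by linarith)
    have := r.eval_le_one (x := 1 - x) (by linarith [hx.2, hξ.2]) (by linarith [hx.1])
    linarith
  have hlt' : ∀ x ∈ Set.Ioc (0 : ℝ) ξ,
      ξ * lams.eval (1 - r.eval (1 - x)) < ξ * lams.eval (1 - rhos.eval (1 - x)) :=
    fun x hx => mul_lt_mul_of_pos_left (hlt x hx) hξ.1
  have hdec' : ∀ x ∈ Set.Ioc (0 : ℝ) ξ, ξ * lams.eval (1 - r.eval (1 - x)) < x :=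
    fun x hx => (hlt' x hx).trans (hdec x hx)
  have hint : ∫ t in (0 : ℝ)..1, r.eval t = ∫ t in (0 : ℝ)..1, rhos.eval t := by
    rw [DegreeDist.integral_eval, DegreeDist.integral_eval, hr, ht, sub_self, mul_zero, add_zero]
  refine (hmin lams r ⟨hlD, hrD'.trans_le hrD, hdec', hint ▸ hrate⟩).not_gt ?_
  have hsub : ∀ x ∈ Set.Icc η ξ, x ∈ Set.Ioc (0 : ℝ) ξ := fun x hx => ⟨hη.1.trans_le hx.1, hx.2⟩
  have hcont : ∀ q : DegreeDist, (∀ x ∈ Set.Ioc (0 : ℝ) ξ, ξ * lams.eval (1 - q.eval (1 - x)) < x) →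
      ContinuousOn (fun x : ℝ => 1 / (x - ξ * lams.eval (1 - q.eval (1 - x)))) (Set.Icc η ξ) := by
    intro q hq
    have := lams.continuous_eval
    have := q.continuous_eval
    exact ContinuousOn.div (by fun_prop) (by fun_prop)
      fun x hx => (sub_pos.2 (hq x (hsub x hx))).ne'
  have hfrac : ∀ x ∈ Set.Ioc (0 : ℝ) ξ, 1 / (x - ξ * lams.eval (1 - r.eval (1 - x))) <
      1 / (x - ξ * lams.eval (1 - rhos.eval (1 - x))) := fun x hx =>
    one_div_lt_one_div_of_lt (sub_pos.2 (hdec x hx)) (by linarith [hlt' x hx])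
  exact intervalIntegral.integral_lt_integral_of_continuousOn_of_le_of_exists_lt hη.2
    (hcont r hdec') (hcont rhos hdec)
    (fun x hx => (hfrac x (hsub x (Set.Ioc_subset_Icc_self hx))).le)
    ⟨ξ, Set.right_mem_Icc.2 hη.2.le, hfrac ξ ⟨hξ.1, le_rfl⟩⟩
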